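/- Let λ > 0 and λ₁, μ, μ₁ ∈ ℝ, and let ν be a real number with ν ∉ [0, 4λ]. Set γ = ν/(2λ) - 1 (so |γ| > 1). Then ν is an eigenvalue of H if and only if either l(γ) = δ or (γ - σ)(l(γ) - δ) = (α + 1)². -/

import Mathlib

/-- The Hamiltonian `H = H₀ + H₁` acting on complex sequences `f : ℤ → ℂ`. -/
noncomputable def Hop (lam lam1 mu mu1 : ℝ) (f : ℤ → ℂ) : ℤ → ℂ := fun n =>
  if n = 0 then -((lam : ℂ) + (lam1 : ℂ)) * (f 1 - 2 * f 0 + f (-1)) + (mu : ℂ) * f 0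
  else if n = 1 then -(lam : ℂ) * (f 2 - 2 * f 1 + f 0) - (lam1 : ℂ) * f 0 + (mu1 : ℂ) * f 1
  else if n = -1 then
    -(lam : ℂ) * (f 0 - 2 * f (-1) + f (-2)) - (lam1 : ℂ) * f 0 + (mu1 : ℂ) * f (-1)
  else -(lam : ℂ) * (f (n + 1) - 2 * f n + f (n - 1))

/-- `ν` is an eigenvalue of `H`: there is a nonzero square-summable `f` with `Hf = νf`. -/
noncomputable def IsEigenvalue (lam lam1 mu mu1 ν : ℝ) : Prop :=
  ∃ f : ℤ → ℂ, f ≠ 0 ∧ Summable (fun n : ℤ => ‖f n‖ ^ 2) ∧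
    ∀ n : ℤ, Hop lam lam1 mu mu1 f n = (ν : ℂ) * f n

/-- The discrete spectrum `s_d(H)`: real eigenvalues outside `[0, 4λ]`. -/
noncomputable def discSpec (lam lam1 mu mu1 : ℝ) : Set ℝ :=
  {ν : ℝ | IsEigenvalue lam lam1 mu mu1 ν ∧ ν ∉ Set.Icc 0 (4 * lam)}

/-- The function `l(γ) = γ(1 + √(1 - γ⁻²))`. -/
noncomputable def lfun (γ : ℝ) : ℝ := γ * (1 + Real.sqrt (1 - (γ ^ 2)⁻¹))

/-- For `|γ| > 1`, `l(γ)` is a root of `x² - 2γx + 1`. -/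
lemma lfun_add_inv {γ : ℝ} (h : 1 < |γ|) : lfun γ + (lfun γ)⁻¹ = 2 * γ := by
  have h0 : γ ≠ 0 := by rintro rfl; norm_num at h
  have hsq : 1 < γ ^ 2 := (one_lt_sq_iff_one_lt_abs γ).2 h
  have hs : 0 ≤ 1 - (γ ^ 2)⁻¹ := sub_nonneg.2 (inv_le_one_of_one_le₀ hsq.le)
  have hq := Real.sq_sqrt hs
  have hp := Real.sqrt_nonneg (1 - (γ ^ 2)⁻¹)
  unfold lfun
  generalize Real.sqrt (1 - (γ ^ 2)⁻¹) = s at hq hp ⊢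
  have h1 : 1 + s ≠ 0 := by positivity
  field_simp at hq ⊢
  linear_combination hq

lemma one_lt_abs_lfun {γ : ℝ} (h : 1 < |γ|) : 1 < |lfun γ| := by
  have hp := Real.sqrt_nonneg (1 - (γ ^ 2)⁻¹)
  rw [lfun, abs_mul, abs_of_nonneg (a := 1 + Real.sqrt _) (by positivity)]
  nlinarith

/-- A null sequence satisfying `g (n + 2) = (q + q⁻¹) g (n + 1) - g n` with `|q| < 1` is
geometric with ratio `q`. -/
lemma eq_geometric_of_tendsto_zero {q : ℂ} (hq0 : q ≠ 0) (hq1 : ‖q‖ < 1) {g : ℕ → ℂ}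
    (hrec : ∀ n, g (n + 2) = (q + q⁻¹) * g (n + 1) - g n)
    (hg : Filter.Tendsto g Filter.atTop (nhds 0)) (n : ℕ) : g n = q ^ n * g 0 := by
  have hd (n : ℕ) : g 1 - q * g 0 = q ^ n * (g (n + 1) - q * g n) := by
    induction n with
    | zero => simp
    | succ k ih =>
      rw [ih, hrec k]
      field_simp
      ring
  have hlim : Filter.Tendsto (fun n => q ^ n * (g (n + 1) - q * g n)) Filter.atTop
      (nhds (0 * (0 - q * 0))) :=
    (tendsto_pow_atTop_nhds_zero_of_norm_lt_one hq1).mul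
      (((Filter.tendsto_add_atTop_iff_nat 1).2 hg).sub (hg.const_mul q))
  have hzero : g 1 - q * g 0 = 0 := by
    have := tendsto_nhds_unique (tendsto_const_nhds.congr hd) hlim
    simpa using this
  have hstep (n : ℕ) : g (n + 1) = q * g n := by
    have h := hd n
    rw [hzero, eq_comm, mul_eq_zero, sub_eq_zero] at h
    exact h.resolve_left (pow_ne_zero n hq0)
  induction n with
  | zero => simp
  | succ k ih => rw [hstep, ih]; ring

/-- The eigenvalue equation in terms of dimensionless parameters, split into the equations at
`0`, `1`, `-1` and the recurrences on the two half-lines. -/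
lemma hop_eq_iff {lam : ℝ} (hlam : lam ≠ 0) (al de si γ : ℝ) (f : ℤ → ℂ) :
    (∀ n, Hop lam (al * lam) (2 * (si - al) * lam) (de * lam) f n
        = ((2 * lam * (γ + 1) : ℝ) : ℂ) * f n) ↔
      ((al + 1 : ℂ) * (f 1 + f (-1)) = 2 * (si - γ) * f 0 ∧
        f 2 + (2 * γ - de) * f 1 + (al + 1) * f 0 = 0 ∧
        f (-2) + (2 * γ - de) * f (-1) + (al + 1) * f 0 = 0) ∧
      (∀ n : ℕ, f (n + 3) = -2 * γ * f (n + 2) - f (n + 1)) ∧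
      (∀ n : ℕ, f (-n - 3) = -2 * γ * f (-n - 2) - f (-n - 1)) := by
  have hl : (lam : ℂ) ≠ 0 := by exact_mod_cast hlam
  constructor
  · intro h
    refine ⟨⟨?_, ?_, ?_⟩, fun n => ?_, fun n => ?_⟩
    · have h0 := h 0
      simp only [Hop, if_true] at h0
      push_cast at h0
      apply mul_left_cancel₀ hl
      linear_combination -h0
    · have h0 := h 1
      norm_num [Hop] at h0
      apply mul_left_cancel₀ hl
      linear_combination -h0
    · have h0 := h (-1)
      norm_num [Hop] at h0
      apply mul_left_cancel₀ hl
      linear_combination -h0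
    · have h0 := h (n + 2)
      rw [Hop, if_neg (by omega), if_neg (by omega), if_neg (by omega),
        show (n + 2 + 1 : ℤ) = n + 3 by ring, show (n + 2 - 1 : ℤ) = n + 1 by ring] at h0
      push_cast at h0
      apply mul_left_cancel₀ hl
      linear_combination -h0
    · have h0 := h (-n - 2)
      rw [Hop, if_neg (by omega), if_neg (by omega), if_neg (by omega),
        show (-n - 2 + 1 : ℤ) = -n - 1 by ring, show (-n - 2 - 1 : ℤ) = -n - 3 by ring] at h0
      push_cast at h0
      apply mul_left_cancel₀ hl
      linear_combination -h0
  · rintro ⟨⟨h0, h1, h2⟩, hp, hm⟩ n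
    rcases lt_trichotomy n 0 with hn | rfl | hn
    · by_cases hn1 : n = -1
      · subst hn1
        norm_num [Hop]
        linear_combination -(lam : ℂ) * h2
      · obtain ⟨k, rfl⟩ : ∃ k : ℕ, n = -k - 2 := ⟨(-n - 2).toNat, by omega⟩
        rw [Hop, if_neg (by omega), if_neg (by omega), if_neg (by omega),
          show (-k - 2 + 1 : ℤ) = -k - 1 by ring, show (-k - 2 - 1 : ℤ) = -k - 3 by ring]
        push_cast
        linear_combination -(lam : ℂ) * hm k
    · simp only [Hop, if_true]
      push_cast
      linear_combination -(lam : ℂ) * h0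
    · by_cases hn1 : n = 1
      · subst hn1
        norm_num [Hop]
        linear_combination -(lam : ℂ) * h1
      · obtain ⟨k, rfl⟩ : ∃ k : ℕ, n = k + 2 := ⟨(n - 2).toNat, by omega⟩
        rw [Hop, if_neg (by omega), if_neg (by omega), if_neg (by omega),
          show (k + 2 + 1 : ℤ) = k + 3 by ring, show (k + 2 - 1 : ℤ) = k + 1 by ring]
        push_cast
        linear_combination -(lam : ℂ) * hp k

/-- The sequence on `ℤ` with value `A` at `0` and geometric tails of ratio `q` starting from `B`
at `1` and from `C` at `-1`. -/
noncomputable def geomTails (q A B C : ℂ) (n : ℤ) : ℂ :=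
  if n = 0 then A else (if 0 < n then B else C) * q ^ (n.natAbs - 1)

lemma geomTails_zero (q A B C : ℂ) : geomTails q A B C 0 = A := by simp [geomTails]

lemma geomTails_pos (q A B C : ℂ) (n : ℕ) : geomTails q A B C (n + 1) = B * q ^ n := by
  rw [geomTails, if_neg (by omega), if_pos (by omega), show ((n : ℤ) + 1).natAbs - 1 = n by omega]

lemma geomTails_neg (q A B C : ℂ) (n : ℕ) : geomTails q A B C (-n - 1) = C * q ^ n := by
  rw [geomTails, if_neg (by omega), if_neg (by omega), show (-(n : ℤ) - 1).natAbs - 1 = n by omega]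

lemma summable_geomTails {q : ℂ} (hq : ‖q‖ < 1) (A B C : ℂ) :
    Summable fun n => ‖geomTails q A B C n‖ ^ 2 := by
  have hgeom (D : ℂ) : Summable fun n : ℕ => ‖D * q ^ n‖ ^ 2 := by
    have := (summable_geometric_of_lt_one (by positivity)
      (pow_lt_one₀ (norm_nonneg q) hq two_ne_zero)).mul_left (‖D‖ ^ 2)
    refine this.congr fun n => ?_
    rw [norm_mul, norm_pow]
    ring
  refine Summable.of_nat_of_neg ((summable_nat_add_iff 1).1 ?_) ((summable_nat_add_iff 1).1 ?_)
  · refine (hgeom B).congr fun n => ?_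
    rw [← geomTails_pos q A B C n]
    push_cast
    rfl
  · refine (hgeom C).congr fun n => ?_
    rw [← geomTails_neg q A B C n, show (-(n : ℤ) - 1) = -((n + 1 : ℕ) : ℤ) by push_cast; ring]

lemma tendsto_zero_of_summable_sq_norm {f : ℤ → ℂ} (hf : Summable fun n => ‖f n‖ ^ 2)
    {e : ℕ → ℤ} (he : Function.Injective e) :
    Filter.Tendsto (fun n => f (e n)) Filter.atTop (nhds 0) := by
  have h := (hf.comp_injective he).tendsto_atTop_zero
  rw [tendsto_zero_iff_norm_tendsto_zero]
  simpa using h.sqrt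

/-- A square-summable solution of the half-line recurrences has geometric tails. -/
lemma eq_geomTails {q : ℂ} (hq0 : q ≠ 0) (hq1 : ‖q‖ < 1) {f : ℤ → ℂ}
    (hf : Summable fun n => ‖f n‖ ^ 2)
    (hp : ∀ n : ℕ, f (n + 3) = (q + q⁻¹) * f (n + 2) - f (n + 1))
    (hm : ∀ n : ℕ, f (-n - 3) = (q + q⁻¹) * f (-n - 2) - f (-n - 1)) :
    f = geomTails q (f 0) (f 1) (f (-1)) := by
  have hp' := eq_geometric_of_tendsto_zero hq0 hq1 (g := fun n : ℕ => f (n + 1))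
    (fun n => by
      have h := hp n
      push_cast
      ring_nf at h ⊢
      exact h)
    (tendsto_zero_of_summable_sq_norm hf fun a b h => by simpa using h)
  have hm' := eq_geometric_of_tendsto_zero hq0 hq1 (g := fun n : ℕ => f (-n - 1))
    (fun n => by
      have h := hm n
      push_cast
      ring_nf at h ⊢
      exact h)
    (tendsto_zero_of_summable_sq_norm hf fun a b h => by simpa using h)
  funext n
  rcases lt_trichotomy n 0 with hn | rfl | hn
  · obtain ⟨k, rfl⟩ : ∃ k : ℕ, n = -k - 1 := ⟨(-n - 1).toNat, by omega⟩
    simpa [geomTails_neg, mul_comm] using hm' k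
  · rw [geomTails_zero]
  · obtain ⟨k, rfl⟩ : ∃ k : ℕ, n = k + 1 := ⟨(n - 1).toNat, by omega⟩
    simpa [geomTails_pos, mul_comm] using hp' k

/-- Outside `[0, 4λ]`, eigenvalues correspond to nonzero solutions of the linear system for the
values at `0`, `1` and `-1`. -/
lemma isEigenvalue_iff_exists {lam : ℝ} (hlam : lam ≠ 0) (al de si : ℝ) {γ : ℝ} (hγ : 1 < |γ|) :
    IsEigenvalue lam (al * lam) (2 * (si - al) * lam) (de * lam) (2 * lam * (γ + 1)) ↔
      ∃ A B C : ℂ, (A ≠ 0 ∨ B ≠ 0 ∨ C ≠ 0) ∧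
        (al + 1) * (B + C) = 2 * (si - γ) * A ∧
        (lfun γ - de) * B + (al + 1) * A = 0 ∧ (lfun γ - de) * C + (al + 1) * A = 0 := by
  have hL1 := one_lt_abs_lfun hγ
  have hL0 : lfun γ ≠ 0 := by
    intro h
    norm_num [h] at hL1
  have hadd : (lfun γ : ℂ) + (lfun γ : ℂ)⁻¹ = 2 * γ := by exact_mod_cast lfun_add_inv hγ
  obtain ⟨q, hq⟩ : ∃ q : ℂ, q = -(lfun γ : ℂ)⁻¹ := ⟨_, rfl⟩
  have hq0 : q ≠ 0 := by simp [hq, hL0]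
  have hq1 : ‖q‖ < 1 := by
    rw [hq, norm_neg, norm_inv, Complex.norm_real, Real.norm_eq_abs]
    exact inv_lt_one_of_one_lt₀ hL1
  have hqq : q + q⁻¹ = -2 * γ := by
    rw [hq, inv_neg, inv_inv]
    linear_combination -hadd
  have hqL : q = lfun γ - 2 * γ := by
    rw [hq]
    linear_combination -hadd
  have h2 (A B C : ℂ) : geomTails q A B C 2 = B * q := by
    simpa [one_add_one_eq_two] using geomTails_pos q A B C 1
  have h1 (A B C : ℂ) : geomTails q A B C 1 = B := by
    simpa using geomTails_pos q A B C 0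
  have hm1 (A B C : ℂ) : geomTails q A B C (-1) = C := by
    simpa using geomTails_neg q A B C 0
  have hm2 (A B C : ℂ) : geomTails q A B C (-2) = C * q := by
    simpa using geomTails_neg q A B C 1
  constructor
  · rintro ⟨f, hf0, hf, hH⟩
    obtain ⟨⟨e0, e1, e2⟩, hp, hm⟩ := (hop_eq_iff hlam al de si γ f).1 hH
    rw [← hqq] at hp hm
    have hfg := eq_geomTails hq0 hq1 hf hp hm
    refine ⟨f 0, f 1, f (-1), ?_, e0, ?_, ?_⟩
    · by_contra! h
      apply hf0
      rw [hfg, h.1, h.2.1, h.2.2]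
      ext n
      simp [geomTails]
    · have := congrFun hfg 2
      rw [h2] at this
      linear_combination e1 - this - f 1 * hqL
    · have := congrFun hfg (-2)
      rw [hm2] at this
      linear_combination e2 - this - f (-1) * hqL
  · rintro ⟨A, B, C, hne, e0, e1, e2⟩
    refine ⟨geomTails q A B C, ?_, summable_geomTails hq1 A B C,
      (hop_eq_iff hlam al de si γ _).2 ⟨⟨?_, ?_, ?_⟩, fun n => ?_, fun n => ?_⟩⟩
    · intro h
      have hA := geomTails_zero q A B C
      have hB := h1 A B C
      have hC := hm1 A B C
      rw [h] at hA hB hC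
      simp_all
    · rw [h1, hm1, geomTails_zero, e0]
    · rw [h2, h1, geomTails_zero]
      linear_combination e1 + B * hqL
    · rw [hm2, hm1, geomTails_zero]
      linear_combination e2 + C * hqL
    · have t2 := geomTails_pos q A B C (n + 1)
      have t3 := geomTails_pos q A B C (n + 2)
      push_cast at t2 t3
      rw [show (n + 3 : ℤ) = n + 2 + 1 by ring, t3, show (n + 2 : ℤ) = n + 1 + 1 by ring, t2,
        geomTails_pos, ← hqq]
      field_simp
      ring
    · have t2 := geomTails_neg q A B C (n + 1)
      have t3 := geomTails_neg q A B C (n + 2)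
      push_cast at t2 t3
      rw [show (-n - 3 : ℤ) = -(n + 2) - 1 by ring, t3, show (-n - 2 : ℤ) = -(n + 1) - 1 by ring,
        t2, geomTails_neg, ← hqq]
      field_simp
      ring

/-- Solvability of the linear system for the values at `0`, `1` and `-1`. -/
lemma exists_ne_zero_iff {a b c : ℂ} :
    (∃ A B C : ℂ, (A ≠ 0 ∨ B ≠ 0 ∨ C ≠ 0) ∧ b * (B + C) = -(2 * c) * A ∧
        a * B + b * A = 0 ∧ a * C + b * A = 0) ↔ a = 0 ∨ c * a = b ^ 2 := by
  constructor
  · rintro ⟨A, B, C, hne, e0, e1, e2⟩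
    by_cases ha : a = 0
    · exact Or.inl ha
    · have hA : A ≠ 0 := by
        rintro rfl
        simp_all
      refine Or.inr (mul_right_cancel₀ hA ?_)
      linear_combination a / 2 * e0 - b / 2 * (e1 + e2)
  · intro h
    by_cases ha : a = 0
    · exact ⟨0, 1, -1, by simp, by simp, by simp [ha], by simp [ha]⟩
    · have h := h.resolve_left ha
      exact ⟨a, -b, -b, Or.inl ha, by linear_combination 2 * h, by ring, by ring⟩

/-- A real `ν ∉ [0, 4λ]` is an eigenvalue of `H` iff, with `γ = ν/(2λ) - 1`, either
`l(γ) = δ` or `(γ - σ)(l(γ) - δ) = (α + 1)²`. -/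
theorem stmt14 (lam lam1 mu mu1 al de si ν γ : ℝ)
    (hlam : 0 < lam)
    (hal : al = lam1 / lam) (hde : de = mu1 / lam) (hsi : si = (2 * lam1 + mu) / (2 * lam))
    (hν : ν ∉ Set.Icc 0 (4 * lam))
    (hγ : γ = ν / (2 * lam) - 1) :
    IsEigenvalue lam lam1 mu mu1 ν ↔
      lfun γ = de ∨ (γ - si) * (lfun γ - de) = (al + 1) ^ 2 := by
  have hl := hlam.ne'
  have hν_eq : ν = 2 * lam * (γ + 1) := by rw [hγ]; field_simp; ring
  have hγ1 : 1 < |γ| := by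
    rw [lt_abs]
    by_contra! h
    exact hν ⟨by nlinarith, by nlinarith⟩
  have hlam1 : lam1 = al * lam := by rw [hal]; field_simp
  have hmu : mu = 2 * (si - al) * lam := by rw [hsi, hal]; field_simp; ring
  have hmu1 : mu1 = de * lam := by rw [hde]; field_simp
  rw [hlam1, hmu, hmu1, hν_eq, isEigenvalue_iff_exists hl al de si hγ1]
  have key := exists_ne_zero_iff (a := lfun γ - de) (b := al + 1) (c := γ - si)
  rw [show -(2 * ((γ : ℂ) - si)) = 2 * (si - γ) by ring] at key
  rw [key, ← sub_eq_zero (a := lfun γ)]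
  norm_cast
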